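/- arXiv:2306.12261 — 3 statements merged into one kernel-verified Lean document; each statement's English description precedes it below -/
import Mathlib

section
/- Let G be a group, m ≥ 1 an integer, r : G → ℤ² a group homomorphism with r(a) = (1, 0) for some a ∈ G, and let ξ : ℤ² → ℤ² be the homomorphism with ξ(1,0) = (m+1, 1) and ξ(0,1) = (m, 1). Let φ : G × ℤ² → G × ℤ² be the automorphism φ(u, v) = (u, r(u) + ξ(v)). Then for all v' = (s', t') and v'' = (s'', t'') in ℤ², the elements (1, v') and (1, v'') of G × ℤ² are φ-twisted conjugate; indeed γ = (a^{s''-s'}, (t''-t', t'-t'')) satisfies γ⁻¹ · (1, v') · φ(γ) = (1, v''). -/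
/-- For a group `G`, an integer `m ≥ 1`, a homomorphism `r : G → ℤ²` with `r(a) = (1,0)`,
and `ξ : ℤ² → ℤ²` with `ξ(1,0) = (m+1,1)`, `ξ(0,1) = (m,1)`, any two elements `(1, v')`
and `(1, v'')` of `G × ℤ²` are twisted conjugate with respect to
`φ(u, v) = (u, r(u) + ξ(v))`; indeed `γ = (a^(s''-s'), (t''-t', t'-t''))` works. -/
theorem stmt8 (G : Type*) [Group G] (m : ℤ) (hm : 1 ≤ m)
    (r : G →* Multiplicative (ℤ × ℤ)) (a : G) (ha : r a = Multiplicative.ofAdd (1, 0))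
    (ξ : (ℤ × ℤ) →+ (ℤ × ℤ)) (hξ1 : ξ (1, 0) = (m + 1, 1)) (hξ2 : ξ (0, 1) = (m, 1))
    (φ : G × Multiplicative (ℤ × ℤ) → G × Multiplicative (ℤ × ℤ))
    (hφ : ∀ (u : G) (v : Multiplicative (ℤ × ℤ)), φ (u, v) =
      (u, Multiplicative.ofAdd (Multiplicative.toAdd (r u) + ξ (Multiplicative.toAdd v)))) :
    ∀ s' t' s'' t'' : ℤ,
      (∃ γ : G × Multiplicative (ℤ × ℤ),
        ((1 : G), Multiplicative.ofAdd ((s'', t'') : ℤ × ℤ)) =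
          γ⁻¹ * ((1 : G), Multiplicative.ofAdd ((s', t') : ℤ × ℤ)) * φ γ) ∧
      (a ^ (s'' - s'), Multiplicative.ofAdd ((t'' - t', t' - t'') : ℤ × ℤ))⁻¹ *
          ((1 : G), Multiplicative.ofAdd ((s', t') : ℤ × ℤ)) *
          φ (a ^ (s'' - s'), Multiplicative.ofAdd ((t'' - t', t' - t'') : ℤ × ℤ)) =
        ((1 : G), Multiplicative.ofAdd ((s'', t'') : ℤ × ℤ)) := by
  intro s' t' s'' t''
  have hξ (x y : ℤ) : ξ (x, y) = (x * (m + 1) + y * m, x + y) := by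
    have h : ((x, y) : ℤ × ℤ) = x • (1, 0) + y • (0, 1) := by simp
    rw [h, map_add, map_zsmul, map_zsmul, hξ1, hξ2]
    simp
  have key : (a ^ (s'' - s'), Multiplicative.ofAdd ((t'' - t', t' - t'') : ℤ × ℤ))⁻¹ *
      ((1 : G), Multiplicative.ofAdd ((s', t') : ℤ × ℤ)) *
      φ (a ^ (s'' - s'), Multiplicative.ofAdd ((t'' - t', t' - t'') : ℤ × ℤ)) =
      ((1 : G), Multiplicative.ofAdd ((s'', t'') : ℤ × ℤ)) := by
    rw [hφ, map_zpow, ha, toAdd_ofAdd, hξ]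
    refine Prod.ext (by simp) ?_
    apply Multiplicative.toAdd.injective
    ext
    · simp
      ring
    · simp
  exact ⟨⟨_, key.symm⟩, key⟩
end

section
/- Let G be a group, m ≥ 1 an integer, r = (r₁, r₂) : G → ℤ² a group homomorphism, and let ξ : ℤ² → ℤ² be the homomorphism with ξ(1,0) = (m+1, 1) and ξ(0,1) = (m, 1). Let φ : G × ℤ² → G × ℤ² be the automorphism φ(u, v) = (u, r(u) + ξ(v)), and let p : G × ℤ² → G be the projection onto the first factor. Then the image under p of the fixed-point set of φ is exactly the subgroup {u ∈ G : m divides r₁(u)}. -/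
/-- An additive endomorphism of `ℤ²` sending the standard basis to `(m + 1, 1)` and `(m, 1)` is
given by the corresponding matrix. -/
theorem addMonoidHom_int_prod_apply {m : ℤ} (ξ : (ℤ × ℤ) →+ (ℤ × ℤ))
    (hξ1 : ξ (1, 0) = (m + 1, 1)) (hξ2 : ξ (0, 1) = (m, 1)) (a b : ℤ) :
    ξ (a, b) = ((m + 1) * a + m * b, a + b) := by
  have h : ((a, b) : ℤ × ℤ) = a • (1, 0) + b • (0, 1) := by simp
  rw [h, map_add, map_zsmul, map_zsmul, hξ1, hξ2]
  ext <;> simp [mul_comm]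

/-- The affine map `v ↦ w + ξ v` has a fixed point if and only if `m` divides the first
coordinate of `w`. -/
theorem exists_add_apply_eq_self_iff {m : ℤ} (ξ : (ℤ × ℤ) →+ (ℤ × ℤ))
    (hξ1 : ξ (1, 0) = (m + 1, 1)) (hξ2 : ξ (0, 1) = (m, 1)) (w : ℤ × ℤ) :
    (∃ v, w + ξ v = v) ↔ m ∣ w.1 := by
  obtain ⟨s, t⟩ := w
  constructor
  · rintro ⟨⟨a, b⟩, h⟩
    rw [addMonoidHom_int_prod_apply ξ hξ1 hξ2, Prod.mk_add_mk, Prod.mk.injEq] at h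
    exact ⟨-(a + b), by linear_combination h.1⟩
  · rintro ⟨k, hk⟩
    refine ⟨(-t, t - k), ?_⟩
    rw [addMonoidHom_int_prod_apply ξ hξ1 hξ2, Prod.mk_add_mk, Prod.mk.injEq]
    exact ⟨by linear_combination hk, by ring⟩

/-- For a group `G`, an integer `m ≥ 1`, a homomorphism `r = (r₁, r₂) : G → ℤ²`, and
`ξ : ℤ² → ℤ²` with `ξ(1,0) = (m+1,1)`, `ξ(0,1) = (m,1)`, the image under the first
projection of the fixed-point set of `φ(u, v) = (u, r(u) + ξ(v))` is exactly
`{u ∈ G : m ∣ r₁(u)}`. -/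
theorem stmt13 (G : Type*) [Group G] (m : ℤ) (hm : 1 ≤ m)
    (r : G →* Multiplicative (ℤ × ℤ))
    (ξ : (ℤ × ℤ) →+ (ℤ × ℤ)) (hξ1 : ξ (1, 0) = (m + 1, 1)) (hξ2 : ξ (0, 1) = (m, 1))
    (φ : G × Multiplicative (ℤ × ℤ) → G × Multiplicative (ℤ × ℤ))
    (hφ : ∀ (u : G) (v : Multiplicative (ℤ × ℤ)), φ (u, v) =
      (u, Multiplicative.ofAdd (Multiplicative.toAdd (r u) + ξ (Multiplicative.toAdd v)))) :
    Prod.fst '' {x : G × Multiplicative (ℤ × ℤ) | φ x = x} =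
      {u : G | m ∣ (Multiplicative.toAdd (r u)).1} := by
  ext u
  rw [Set.mem_ofPred_eq, ← exists_add_apply_eq_self_iff ξ hξ1 hξ2]
  constructor
  · rintro ⟨⟨u, v⟩, h, rfl⟩
    rw [Set.mem_ofPred_eq, hφ] at h
    exact ⟨Multiplicative.toAdd v, congrArg (fun x => Multiplicative.toAdd x.2) h⟩
  · rintro ⟨v, h⟩
    refine ⟨(u, Multiplicative.ofAdd v), ?_, rfl⟩
    rw [Set.mem_ofPred_eq, hφ, toAdd_ofAdd, h]
end

section
/- Let G be a group, m ≥ 1 an integer, r = (r₁, r₂) : G → ℤ² a group homomorphism such that r₁ : G → ℤ is surjective, and let ξ : ℤ² → ℤ² be the homomorphism with ξ(1,0) = (m+1, 1) and ξ(0,1) = (m, 1). Let φ : G × ℤ² → G × ℤ² be the automorphism φ(u, v) = (u, r(u) + ξ(v)), and let p : G × ℤ² → G be the projection onto the first factor. Then the subgroup p(fix φ) of G has index exactly m in G. -/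
/-- For a group `G`, an integer `m ≥ 1`, a homomorphism `r = (r₁, r₂) : G → ℤ²` with `r₁`
surjective, and `ξ : ℤ² → ℤ²` with `ξ(1,0) = (m+1,1)`, `ξ(0,1) = (m,1)`, the subgroup
`p(fix φ)` of `G` (where `φ(u, v) = (u, r(u) + ξ(v))` and `p` is the first projection)
has index exactly `m` in `G`. -/
theorem stmt14 (G : Type*) [Group G] (m : ℕ) (hm : 1 ≤ m)
    (r : G →* Multiplicative (ℤ × ℤ))
    (hr1 : Function.Surjective (fun u : G => (Multiplicative.toAdd (r u)).1))
    (ξ : (ℤ × ℤ) →+ (ℤ × ℤ))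
    (hξ1 : ξ (1, 0) = ((m : ℤ) + 1, 1)) (hξ2 : ξ (0, 1) = ((m : ℤ), 1))
    (φ : G × Multiplicative (ℤ × ℤ) → G × Multiplicative (ℤ × ℤ))
    (hφ : ∀ (u : G) (v : Multiplicative (ℤ × ℤ)), φ (u, v) =
      (u, Multiplicative.ofAdd (Multiplicative.toAdd (r u) + ξ (Multiplicative.toAdd v))))
    (H : Subgroup G)
    (hH : (H : Set G) = Prod.fst '' {x : G × Multiplicative (ℤ × ℤ) | φ x = x}) :
    H.index = m := by
  have ξ_apply (a b : ℤ) : ξ (a, b) = ((m + 1) * a + m * b, a + b) := by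
    have hab : ((a, b) : ℤ × ℤ) = a • (1, 0) + b • (0, 1) := by simp
    rw [hab, map_add, map_zsmul, map_zsmul, hξ1, hξ2]
    ext <;> simp
    ring
  have mem_H (u : G) : u ∈ H ↔ (m : ℤ) ∣ (r u).toAdd.1 := by
    have fix_iff (a b : ℤ) : φ (u, Multiplicative.ofAdd (a, b)) = (u, Multiplicative.ofAdd (a, b)) ↔
        (r u).toAdd.1 + ((m + 1) * a + m * b) = a ∧ (r u).toAdd.2 + (a + b) = b := by
      rw [hφ, Prod.mk_right_inj, Multiplicative.ofAdd.apply_eq_iff_eq, toAdd_ofAdd, ξ_apply,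
        Prod.ext_iff]
      rfl
    rw [← SetLike.mem_coe, hH]
    constructor
    · rintro ⟨⟨u, a, b⟩, hx, rfl⟩
      exact ⟨-(a + b), by linear_combination ((fix_iff a b).1 hx).1⟩
    · rintro ⟨k, hk⟩
      refine ⟨(u, Multiplicative.ofAdd (-(r u).toAdd.2, (r u).toAdd.2 - k)), ?_, rfl⟩
      exact (fix_iff _ _).2 ⟨by rw [hk]; ring, by ring⟩
  let f : G →* Multiplicative (ZMod m) :=
    (AddMonoidHom.toMultiplicative ((Int.castAddHom (ZMod m)).comp (AddMonoidHom.fst ℤ ℤ))).comp r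
  have hf : Function.Surjective f := by
    intro z
    obtain ⟨k, hk⟩ := ZMod.intCast_surjective z.toAdd
    obtain ⟨u, rfl⟩ := hr1 k
    exact ⟨u, hk⟩
  have H_eq : H = f.ker := by
    ext u
    rw [mem_H, ← ZMod.intCast_zmod_eq_zero_iff_dvd, MonoidHom.mem_ker]
    rfl
  rw [H_eq, Subgroup.index_ker, MonoidHom.range_eq_top.2 hf, Subgroup.card_top]
  exact Nat.card_zmod m
end
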